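/- (Cardinality of robust I-typical sets.) Let P be a probability mass function on 𝒳, let Λ ⊆ Θ, and let (δ_n) be a δ-sequence (δ_n → 0 and √n·δ_n → ∞). Assume 𝒲_Λ is a relatively τ₀-open subset of 𝒲_Λ ∪ 𝒫_n(𝒴|𝒳) for all n (every V ∈ 𝒲_Λ has a total-variation neighborhood whose intersection with the set of empirical conditional PMs of length-n pairs is contained in 𝒲_Λ). Then there exist a sequence η_n → 0 and an index n₀ such that for all n ≥ n₀ and every x ∈ T_Pⁿ(δ_n): | n⁻¹ log |B_Λⁿ(x, δ_n)| − H(𝒲_Λ|P) | ≤ η_n, where |·| denotes cardinality. -/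

import Mathlib

open scoped BigOperators
open Finset

section Defs

variable {Θ X Y : Type}

/-- Probability of the output set `B` under the `n`-fold memoryless extension
`Wⁿ(B|x,θ) = ∑_{y∈B} ∏ᵢ W(yᵢ|xᵢ,θ)`. -/
noncomputable def Wn [Fintype Y] (W : Θ → X → Y → ℝ) (n : ℕ) (θ : Θ)
    (x : Fin n → X) (B : Finset (Fin n → Y)) : ℝ :=
  ∑ y ∈ B, ∏ i, W θ (x i) (y i)

/-- Empirical probability mass function `P̂ₓ` of a sequence `x ∈ 𝒳ⁿ`. -/
noncomputable def emp [DecidableEq X] (n : ℕ) (x : Fin n → X) (a : X) : ℝ :=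
  ((Finset.univ.filter fun i => x i = a).card : ℝ) / (n : ℝ)

/-- Empirical conditional pmf `Ŵ_{x,y}` of `y` given `x`. -/
noncomputable def empCond [DecidableEq X] [DecidableEq Y] (n : ℕ)
    (x : Fin n → X) (y : Fin n → Y) (a : X) (b : Y) : ℝ :=
  ((Finset.univ.filter fun i => x i = a ∧ y i = b).card : ℝ) /
    ((Finset.univ.filter fun i => x i = a).card : ℝ)

/-- Kullback–Leibler divergence `D(Q‖P)` (real-valued sum; paired with `absCont`
to encode the `+∞` convention). -/
noncomputable def klDiv [Fintype X] (Q P : X → ℝ) : ℝ :=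
  ∑ a, Q a * Real.log (Q a / P a)

/-- Absolute continuity `Q ≪ P` (finiteness of `D(Q‖P)`). -/
def absCont [Fintype X] (Q P : X → ℝ) : Prop := ∀ a, Q a ≠ 0 → P a ≠ 0

/-- Conditional Kullback–Leibler divergence `D(V‖W|P)` (real-valued sum; paired
with `condAbsCont` to encode the `+∞` convention). -/
noncomputable def condKL [Fintype X] [Fintype Y] (P : X → ℝ) (V W : X → Y → ℝ) : ℝ :=
  ∑ a, P a * ∑ b, V a b * Real.log (V a b / W a b)

/-- Conditional absolute continuity (finiteness of `D(V‖W|P)`). -/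
def condAbsCont (P : X → ℝ) (V W : X → Y → ℝ) : Prop :=
  ∀ a b, P a ≠ 0 → V a b ≠ 0 → W a b ≠ 0

/-- Conditional entropy `H(V|P)`. -/
noncomputable def condEnt [Fintype X] [Fintype Y] (P : X → ℝ) (V : X → Y → ℝ) : ℝ :=
  -∑ a, P a * ∑ b, V a b * Real.log (V a b)

/-- Shannon entropy of a pmf on `Y`. -/
noncomputable def ent [Fintype Y] (Q : Y → ℝ) : ℝ := -∑ b, Q b * Real.log (Q b)

/-- Mutual information `I(P, V)`. -/
noncomputable def mutInfo [Fintype X] [Fintype Y] (P : X → ℝ) (V : X → Y → ℝ) : ℝ :=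
  ∑ a, ∑ b, P a * V a b * Real.log (V a b / ∑ a', P a' * V a' b)

/-- `P` is a probability mass function. -/
def IsPM [Fintype X] (P : X → ℝ) : Prop := (∀ a, 0 ≤ P a) ∧ ∑ a, P a = 1

/-- `V` is a channel from `X` to `Y`. -/
def IsChannel [Fintype Y] (V : X → Y → ℝ) : Prop :=
  (∀ a b, 0 ≤ V a b) ∧ ∀ a, ∑ b, V a b = 1

open scoped Classical in
/-- I-typical input sequences `T_Pⁿ(δ) = {x : D(P̂ₓ‖P) ≤ δ}`. -/
noncomputable def typX [Fintype X] [DecidableEq X] (P : X → ℝ) (n : ℕ) (δ : ℝ) :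
    Finset (Fin n → X) :=
  Finset.univ.filter fun x => absCont (emp n x) P ∧ klDiv (emp n x) P ≤ δ

open scoped Classical in
/-- Conditionally I-typical output sequences `T_Vⁿ(x, δ) = {y : D(Ŵ_{x,y}‖V|P̂ₓ) ≤ δ}`. -/
noncomputable def typY [Fintype X] [Fintype Y] [DecidableEq X] [DecidableEq Y]
    (V : X → Y → ℝ) (n : ℕ) (x : Fin n → X) (δ : ℝ) : Finset (Fin n → Y) :=
  Finset.univ.filter fun y =>
    condAbsCont (emp n x) (empCond n x y) V ∧ condKL (emp n x) (empCond n x y) V ≤ δ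

open scoped Classical in
/-- Robust I-typical set `B_Λⁿ(x, δ) = ⋃_{θ∈Λ} T_{W_θ}ⁿ(x, δ)`. -/
noncomputable def robustTyp [Fintype X] [Fintype Y] [DecidableEq X] [DecidableEq Y]
    (W : Θ → X → Y → ℝ) (n : ℕ) (Λ : Set Θ) (x : Fin n → X) (δ : ℝ) :
    Finset (Fin n → Y) :=
  Finset.univ.filter fun y => ∃ θ ∈ Λ, y ∈ typY (W θ) n x δ

/-- The set `Λ_ε` of channel states at which the maximal error probability of the
code `(c, D)` is at most `ε`. -/
def lambdaSet [Fintype X] [Fintype Y] [DecidableEq X] [DecidableEq Y]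
    (W : Θ → X → Y → ℝ) {n M : ℕ}
    (c : Fin M → Fin n → X) (D : Fin M → Finset (Fin n → Y)) (ε : ℝ) : Set Θ :=
  {θ | ∀ m, Wn W n θ (c m) (D m)ᶜ ≤ ε}

/-- Minimal cardinality `g_Λ(A, η)` of a common `η`-image of `A` via `𝒲_Λ`. -/
noncomputable def gMin [Fintype X] [Fintype Y] (W : Θ → X → Y → ℝ) (n : ℕ)
    (Λ : Set Θ) (A : Finset (Fin n → X)) (η : ℝ) : ℕ :=
  sInf {k : ℕ | ∃ B : Finset (Fin n → Y), B.card = k ∧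
    ∀ x ∈ A, ∀ θ ∈ Λ, η ≤ Wn W n θ x B}

/-- `H(𝒲_Λ|P) = sup_{θ∈Λ} H(W_θ|P)`. -/
noncomputable def entSup [Fintype X] [Fintype Y] (W : Θ → X → Y → ℝ) (Λ : Set Θ)
    (P : X → ℝ) : ℝ :=
  sSup ((fun θ => condEnt P (W θ)) '' Λ)

/-- The set `𝒫_n(𝒴|𝒳)` of empirical conditional pmfs of length-`n` pairs. -/
def empCondSet (X Y : Type) [DecidableEq X] [DecidableEq Y] (n : ℕ) :
    Set (X → Y → ℝ) :=
  {V | ∃ (x : Fin n → X) (y : Fin n → Y), V = fun a b => empCond n x y a b}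

/-- `F` is a relatively τ₀-open subset of `F ∪ Pn`: every `V ∈ F` has a
total-variation neighborhood whose intersection with `Pn` is contained in `F`. -/
def relOpen (F Pn : Set (X → Y → ℝ)) : Prop :=
  ∀ V ∈ F, ∃ r > 0, ∀ V' ∈ Pn, (∀ a b, |V' a b - V a b| < r) → V' ∈ F

/-- A δ-sequence: `δ_n → 0` and `√n · δ_n → ∞`. -/
def IsDeltaSeq (δseq : ℕ → ℝ) : Prop :=
  Filter.Tendsto δseq Filter.atTop (nhds 0) ∧
    Filter.Tendsto (fun n : ℕ => Real.sqrt n * δseq n) Filter.atTop Filter.atTop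

open scoped Classical in
/-- Union over `V ∈ F` of exact conditional type classes `T_Vⁿ(x)`. -/
noncomputable def exactUnion [Fintype X] [Fintype Y] [DecidableEq X] [DecidableEq Y]
    (F : Set (X → Y → ℝ)) (n : ℕ) (x : Fin n → X) : Finset (Fin n → Y) :=
  Finset.univ.filter fun y => ∃ V ∈ F, ∀ a b, empCond n x y a b = V a b

open scoped Classical in
/-- Union over `V ∈ F` of divergence shells `T_Vⁿ(x, ε)`. -/
noncomputable def shellUnion [Fintype X] [Fintype Y] [DecidableEq X] [DecidableEq Y]
    (F : Set (X → Y → ℝ)) (n : ℕ) (x : Fin n → X) (ε : ℝ) : Finset (Fin n → Y) :=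
  Finset.univ.filter fun y => ∃ V ∈ F, y ∈ typY V n x ε

/-- The capacity expression `𝒞(γ, P) = sup_{Λ : μ(Λ) ≥ 1-γ} inf_{θ∈Λ} I(P, W_θ)`. -/
noncomputable def ratesFormula [Fintype X] [Fintype Y] [MeasurableSpace Θ]
    (μ : MeasureTheory.Measure Θ) (W : Θ → X → Y → ℝ) (γ : ℝ) (P : X → ℝ) : ℝ :=
  sSup {r : ℝ | ∃ Λ : Set Θ, MeasurableSet Λ ∧ ENNReal.ofReal (1 - γ) ≤ μ Λ ∧
    r = sInf ((fun θ => mutInfo P (W θ)) '' Λ)}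

/-- A rate `R` is `(ε,γ)`-achievable: for every `δ > 0` and all sufficiently
large `n` there is a length-`n` code of size `M`, with all codewords satisfying
the cost constraint, such that `μ(Λ_ε) ≥ 1-γ` and `n⁻¹ log M ≥ R - δ`. -/
def Achievable [Fintype X] [Fintype Y] [DecidableEq X] [DecidableEq Y] [MeasurableSpace Θ]
    (μ : MeasureTheory.Measure Θ) (W : Θ → X → Y → ℝ) (Γ : X → ℝ)
    (Pbudget γ ε R : ℝ) : Prop :=
  ∀ δ : ℝ, 0 < δ → ∃ N : ℕ, ∀ n : ℕ, N ≤ n →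
    ∃ (M : ℕ) (c : Fin M → Fin n → X) (D : Fin M → Finset (Fin n → Y)),
      0 < M ∧
      (∀ m, ∑ a, Γ a * emp n (c m) a ≤ Pbudget) ∧
      (∀ m m', m ≠ m' → Disjoint (D m) (D m')) ∧
      ENNReal.ofReal (1 - γ) ≤ μ (lambdaSet W c D ε) ∧
      R - δ ≤ (n : ℝ)⁻¹ * Real.log M

end Defs

/-- If two nonnegative vectors of equal mass, with entries at most one, have divergence at most
`δ`, then they differ by at most `2 √δ` in each coordinate. -/
theorem abs_sub_le_of_sum_mul_log_le {ι : Type*} [Fintype ι] (q p : ι → ℝ) (δ : ℝ)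
    (hq : ∀ i, 0 ≤ q i) (hp : ∀ i, 0 ≤ p i) (hq1 : ∀ i, q i ≤ 1) (hp1 : ∀ i, p i ≤ 1)
    (hsum : ∑ i, q i = ∑ i, p i) (hac : ∀ i, q i ≠ 0 → p i ≠ 0)
    (hD : ∑ i, q i * Real.log (q i / p i) ≤ δ) (i : ι) :
    |q i - p i| ≤ 2 * √δ := by
  have key : ∀ j, (√(q j) - √(p j)) ^ 2 + (q j - p j) ≤ q j * Real.log (q j / p j) := by
    intro j
    have hsq := Real.sq_sqrt (hq j)
    have hsp := Real.sq_sqrt (hp j)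
    rcases (hq j).eq_or_lt with h0 | hqpos
    · rw [← h0]
      simp [hsp]
    · have hppos : 0 < p j := lt_of_le_of_ne (hp j) (hac j hqpos.ne').symm
      have hsqpos := Real.sqrt_pos.2 hqpos
      have hsppos := Real.sqrt_pos.2 hppos
      have hlog := Real.log_le_sub_one_of_pos (div_pos hsppos hsqpos)
      have heq : Real.log (q j / p j) = -2 * Real.log (√(p j) / √(q j)) := by
        rw [Real.log_div hqpos.ne' hppos.ne', Real.log_div hsppos.ne' hsqpos.ne',
          Real.log_sqrt (hq j), Real.log_sqrt (hp j)]
        ring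
      have hmul : q j * (√(p j) / √(q j)) = √(q j) * √(p j) := by
        nth_rewrite 1 [← hsq]
        field_simp
      rw [heq]
      nlinarith [mul_le_mul_of_nonneg_left hlog (hq j)]
  have hS : ∑ j, (√(q j) - √(p j)) ^ 2 ≤ δ := by
    have := Finset.sum_le_sum fun j (_ : j ∈ Finset.univ) => key j
    rw [Finset.sum_add_distrib, Finset.sum_sub_distrib, hsum] at this
    linarith
  have hi : (√(q i) - √(p i)) ^ 2 ≤ δ :=
    (Finset.single_le_sum (f := fun j => (√(q j) - √(p j)) ^ 2)
      (fun j _ => sq_nonneg _) (Finset.mem_univ i)).trans hS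
  have habs : |√(q i) - √(p i)| ≤ √δ := Real.abs_le_sqrt hi
  have hfac : q i - p i = (√(q i) + √(p i)) * (√(q i) - √(p i)) := by
    nlinarith [Real.sq_sqrt (hq i), Real.sq_sqrt (hp i)]
  have h1 := Real.sqrt_le_one.2 (hq1 i)
  have h2 := Real.sqrt_le_one.2 (hp1 i)
  rw [hfac, abs_mul, abs_of_nonneg (by positivity)]
  exact mul_le_mul (by linarith) habs (abs_nonneg _) (by norm_num)

theorem sum_prod_eq_one {X Y : Type*} [Fintype Y] {n : ℕ} (x : Fin n → X) (V : X → Y → ℝ)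
    (hV : ∀ i, ∑ b, V (x i) b = 1) : ∑ y : Fin n → Y, ∏ i, V (x i) (y i) = 1 := by
  rw [← Fintype.prod_sum (fun i b => V (x i) b)]
  simp [hV]

section EmpiricalLemmas

variable {X Y : Type} [DecidableEq X] [DecidableEq Y]

theorem emp_nonneg {n : ℕ} (x : Fin n → X) (a : X) : 0 ≤ emp n x a := by
  unfold emp; positivity

theorem empCond_nonneg {n : ℕ} (x : Fin n → X) (y : Fin n → Y) (a : X) (b : Y) :
    0 ≤ empCond n x y a b := by
  unfold empCond; positivity

theorem sum_empCond [Fintype Y] {n : ℕ} (x : Fin n → X) (y : Fin n → Y) (a : X) (ha : emp n x a ≠ 0) :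
    ∑ b, empCond n x y a b = 1 := by
  have hc : ((Finset.univ.filter fun i => x i = a).card : ℝ) ≠ 0 := by
    intro h
    exact ha (by simp [emp, h])
  unfold empCond
  rw [← Finset.sum_div, div_eq_one_iff_eq hc, ← Nat.cast_sum,
    Finset.card_eq_sum_card_fiberwise (f := y) (t := Finset.univ) (by simp)]
  simp [Finset.filter_filter]

theorem emp_apply_pos {n : ℕ} (x : Fin n → X) (i : Fin n) : 0 < emp n x (x i) := by
  unfold emp
  have : 0 < (Finset.univ.filter fun j => x j = x i).card :=
    Finset.card_pos.2 ⟨i, by simp⟩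
  have hn : 0 < n := i.pos
  positivity

theorem empCond_apply_pos {n : ℕ} (x : Fin n → X) (y : Fin n → Y) (i : Fin n) :
    0 < empCond n x y (x i) (y i) := by
  unfold empCond
  have h1 : 0 < (Finset.univ.filter fun j => x j = x i).card :=
    Finset.card_pos.2 ⟨i, by simp⟩
  have h2 : 0 < (Finset.univ.filter fun j => x j = x i ∧ y j = y i).card :=
    Finset.card_pos.2 ⟨i, by simp⟩
  positivity

theorem emp_mul_empCond {n : ℕ} (x : Fin n → X) (y : Fin n → Y) (a : X) (b : Y) :
    n * (emp n x a * empCond n x y a b) =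
      ((Finset.univ.filter fun i => x i = a ∧ y i = b).card : ℝ) := by
  rcases Nat.eq_zero_or_pos n with rfl | hn
  · simp
  have hn' : (n : ℝ) ≠ 0 := by positivity
  unfold emp empCond
  by_cases hc : (Finset.univ.filter fun i => x i = a).card = 0
  · have h0 : (Finset.univ.filter fun i => x i = a ∧ y i = b).card = 0 := by
      refine Nat.le_zero.1 (hc ▸ Finset.card_le_card ?_)
      intro i
      simp only [Finset.mem_filter]
      tauto
    simp [hc, h0]
  · have hc' : ((Finset.univ.filter fun i => x i = a).card : ℝ) ≠ 0 := by exact_mod_cast hc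
    field_simp

theorem sum_apply_eq_emp [Fintype X] [Fintype Y] {n : ℕ} (x : Fin n → X) (y : Fin n → Y) (g : X → Y → ℝ) :
    ∑ i, g (x i) (y i) = n * ∑ a, emp n x a * ∑ b, empCond n x y a b * g a b := by
  have h : ∀ a, n * (emp n x a * ∑ b, empCond n x y a b * g a b) =
      ∑ b, ((Finset.univ.filter fun i => x i = a ∧ y i = b).card : ℝ) * g a b := by
    intro a
    rw [Finset.mul_sum, Finset.mul_sum]
    refine Finset.sum_congr rfl fun b _ => ?_
    rw [← emp_mul_empCond]
    ring
  rw [Finset.mul_sum, Finset.sum_congr rfl fun a _ => h a]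
  have hi : ∀ i, g (x i) (y i) = ∑ a, ∑ b, if x i = a ∧ y i = b then g a b else 0 := by
    intro i
    simp [ite_and]
  rw [Finset.sum_congr rfl fun i _ => hi i, Finset.sum_comm]
  refine Finset.sum_congr rfl fun a _ => ?_
  rw [Finset.sum_comm]
  refine Finset.sum_congr rfl fun b _ => ?_
  rw [← Finset.sum_filter, Finset.sum_const, nsmul_eq_mul]

theorem sum_emp [Fintype X] {n : ℕ} (hn : 0 < n) (x : Fin n → X) : ∑ a, emp n x a = 1 := by
  have hn' : (n : ℝ) ≠ 0 := by positivity
  unfold emp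
  rw [← Finset.sum_div, div_eq_one_iff_eq hn', ← Nat.cast_sum,
    ← Finset.card_eq_sum_card_fiberwise (f := x) (t := Finset.univ) (by simp)]
  simp

/-- The probability of `y` given `x` under its own empirical conditional pmf. -/
theorem prod_empCond [Fintype X] [Fintype Y] {n : ℕ} (x : Fin n → X) (y : Fin n → Y) :
    ∏ i, empCond n x y (x i) (y i) =
      Real.exp (-(n * condEnt (emp n x) (empCond n x y))) := by
  rw [condEnt, mul_neg, neg_neg,
    ← sum_apply_eq_emp x y (fun a b => Real.log (empCond n x y a b)), Real.exp_sum]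
  exact Finset.prod_congr rfl fun i _ => (Real.exp_log (empCond_apply_pos x y i)).symm

/-- The probability of `y` given `x` under a channel dominating its empirical conditional pmf. -/
theorem prod_channel_eq [Fintype X] [Fintype Y] {n : ℕ} (x : Fin n → X) (y : Fin n → Y) (V : X → Y → ℝ)
    (hV : IsChannel V) (hac : condAbsCont (emp n x) (empCond n x y) V) :
    ∏ i, V (x i) (y i) = (∏ i, empCond n x y (x i) (y i)) *
      Real.exp (-(n * condKL (emp n x) (empCond n x y) V)) := by
  rw [condKL, ← sum_apply_eq_emp x y (fun a b => Real.log (empCond n x y a b / V a b)),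
    ← Finset.sum_neg_distrib, Real.exp_sum, ← Finset.prod_mul_distrib]
  refine Finset.prod_congr rfl fun i _ => ?_
  have hc := empCond_apply_pos x y i
  have hVpos : 0 < V (x i) (y i) := lt_of_le_of_ne (hV.1 _ _)
    (hac _ _ (emp_apply_pos x i).ne' hc.ne').symm
  rw [Real.exp_neg, Real.exp_log (div_pos hc hVpos)]
  field_simp

theorem prod_channel_eq_zero {n : ℕ} (x : Fin n → X) (y : Fin n → Y) (V : X → Y → ℝ)
    (hac : ¬ condAbsCont (emp n x) (empCond n x y) V) :
    ∏ i, V (x i) (y i) = 0 := by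
  unfold condAbsCont at hac
  push Not at hac
  obtain ⟨a, b, -, hc, hV⟩ := hac
  have hne : (Finset.univ.filter fun i => x i = a ∧ y i = b).card ≠ 0 := by
    intro h
    exact hc (by simp [empCond, h])
  obtain ⟨i, hi⟩ := Finset.card_ne_zero.1 hne
  obtain ⟨rfl, rfl⟩ := (Finset.mem_filter.1 hi).2
  exact Finset.prod_eq_zero (Finset.mem_univ i) hV

/-- Type counting: the total mass given by each `y` to itself is at most the number of joint
types. -/
theorem sum_prod_empCond_le [Fintype X] [Fintype Y] {n : ℕ} (x : Fin n → X) :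
    ∑ y : Fin n → Y, ∏ i, empCond n x y (x i) (y i) ≤
      ((n : ℝ) + 1) ^ (Fintype.card (X × Y)) := by
  let N : (Fin n → Y) → (X × Y → Fin (n + 1)) := fun y p =>
    ⟨(Finset.univ.filter fun i => x i = p.1 ∧ y i = p.2).card, by
      have := Finset.card_filter_le (Finset.univ : Finset (Fin n))
        (fun i => x i = p.1 ∧ y i = p.2)
      simp only [Finset.card_univ, Fintype.card_fin] at this
      omega⟩
  have hN : ∀ y z, N y = N z → empCond n x y = empCond n x z := by
    intro y z h
    funext a b
    have := congrArg Fin.val (congrFun h (a, b))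
    simp only [N] at this
    simp [empCond, this]
  rw [← Finset.sum_fiberwise Finset.univ N]
  have hle : ∀ t : X × Y → Fin (n + 1),
      ∑ y with N y = t, ∏ i, empCond n x y (x i) (y i) ≤ 1 := by
    intro t
    rcases (Finset.univ.filter fun y => N y = t).eq_empty_or_nonempty with h | ⟨z, hz⟩
    · simp [h]
    · have hzt := (Finset.mem_filter.1 hz).2
      calc ∑ y with N y = t, ∏ i, empCond n x y (x i) (y i)
          = ∑ y with N y = t, ∏ i, empCond n x z (x i) (y i) := by
            refine Finset.sum_congr rfl fun y hy => ?_
            rw [hN y z ((Finset.mem_filter.1 hy).2.trans hzt.symm)]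
        _ ≤ ∑ y : Fin n → Y, ∏ i, empCond n x z (x i) (y i) :=
            Finset.sum_le_sum_of_subset_of_nonneg (Finset.subset_univ _)
              fun y _ _ => Finset.prod_nonneg fun i _ => empCond_nonneg x z _ _
        _ = 1 := sum_prod_eq_one x _ fun i => sum_empCond x z _ (emp_apply_pos x i).ne'
  refine (Finset.sum_le_sum fun t _ => hle t).trans ?_
  simp

/-- The complement of a conditionally typical set has exponentially small probability. -/
theorem sum_not_typY_le [Fintype X] [Fintype Y] {n : ℕ} (x : Fin n → X) (V : X → Y → ℝ) (hV : IsChannel V) (δ : ℝ) :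
    ∑ y ∈ (typY V n x δ)ᶜ, ∏ i, V (x i) (y i) ≤
      ((n : ℝ) + 1) ^ (Fintype.card (X × Y)) * Real.exp (-(n * δ)) := by
  have hpt : ∀ y ∈ (typY V n x δ)ᶜ, ∏ i, V (x i) (y i) ≤
      (∏ i, empCond n x y (x i) (y i)) * Real.exp (-(n * δ)) := by
    intro y hy
    have hnn : 0 ≤ ∏ i, empCond n x y (x i) (y i) :=
      Finset.prod_nonneg fun i _ => empCond_nonneg x y _ _
    by_cases hac : condAbsCont (emp n x) (empCond n x y) V
    · have hD : δ ≤ condKL (emp n x) (empCond n x y) V := by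
        by_contra h
        exact Finset.mem_compl.1 hy (by simp [typY, hac, (not_le.1 h).le])
      rw [prod_channel_eq x y V hV hac]
      gcongr
    · rw [prod_channel_eq_zero x y V hac]
      positivity
  calc ∑ y ∈ (typY V n x δ)ᶜ, ∏ i, V (x i) (y i)
      ≤ ∑ y ∈ (typY V n x δ)ᶜ,
          (∏ i, empCond n x y (x i) (y i)) * Real.exp (-(n * δ)) := Finset.sum_le_sum hpt
    _ ≤ ∑ y : Fin n → Y, (∏ i, empCond n x y (x i) (y i)) * Real.exp (-(n * δ)) :=
        Finset.sum_le_sum_of_subset_of_nonneg (Finset.subset_univ _) fun y _ _ =>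
          mul_nonneg (Finset.prod_nonneg fun i _ => empCond_nonneg x y _ _) (Real.exp_nonneg _)
    _ ≤ _ := by
        rw [← Finset.sum_mul]
        gcongr
        exact sum_prod_empCond_le x

end EmpiricalLemmas

theorem IsChannel.le_one {X Y : Type} [Fintype Y] {V : X → Y → ℝ} (hV : IsChannel V) (a : X) (b : Y) : V a b ≤ 1 :=
  (hV.2 a).symm ▸ Finset.single_le_sum (f := V a) (fun j _ => hV.1 a j) (Finset.mem_univ b)

section Continuity

variable {X Y : Type} [Fintype X] [Fintype Y]

theorem condEnt_eq_sum_negMulLog (P : X → ℝ) (V : X → Y → ℝ)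
    (hV : ∀ a, P a ≠ 0 → ∑ b, V a b = 1) :
    condEnt P V =
      ∑ a, (∑ b, Real.negMulLog (P a * V a b) - Real.negMulLog (P a)) := by
  rw [condEnt, ← Finset.sum_neg_distrib]
  refine Finset.sum_congr rfl fun a _ => ?_
  by_cases ha : P a = 0
  · simp [ha]
  · simp_rw [Real.negMulLog_mul, Finset.sum_add_distrib, ← Finset.sum_mul, ← Finset.mul_sum,
      hV a ha, Real.negMulLog]
    simp only [neg_mul, Finset.sum_neg_distrib]
    ring

theorem IsPM.le_one {P : X → ℝ} (hP : IsPM P) (a : X) : P a ≤ 1 :=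
  hP.2.symm ▸ Finset.single_le_sum (f := P) (fun j _ => hP.1 j) (Finset.mem_univ a)

theorem condEnt_le_card {P : X → ℝ} (hP : IsPM P) {V : X → Y → ℝ} (hV : IsChannel V) :
    condEnt P V ≤ Fintype.card Y := by
  have h : ∀ a, -(P a * ∑ b, V a b * Real.log (V a b)) ≤ P a * Fintype.card Y := by
    intro a
    rw [← mul_neg, ← Finset.sum_neg_distrib]
    refine mul_le_mul_of_nonneg_left ?_ (hP.1 a)
    have hb : ∀ b, -(V a b * Real.log (V a b)) ≤ 1 := by
      intro b
      rcases (hV.1 a b).eq_or_lt with h0 | hpos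
      · rw [← h0]; simp
      · have := Real.one_sub_inv_le_log_of_pos hpos
        have h2 := mul_le_mul_of_nonneg_left this hpos.le
        rw [mul_sub, mul_inv_cancel₀ hpos.ne'] at h2
        linarith
    simpa using Finset.sum_le_sum fun b (_ : b ∈ Finset.univ) => hb b
  rw [condEnt, ← Finset.sum_neg_distrib]
  refine (Finset.sum_le_sum fun a _ => h a).trans ?_
  rw [← Finset.sum_mul, hP.2, one_mul]

theorem condKL_nonneg (P : X → ℝ) (V W : X → Y → ℝ) (hP : ∀ a, 0 ≤ P a)
    (hV : ∀ a b, 0 ≤ V a b) (hV1 : ∀ a, P a ≠ 0 → ∑ b, V a b = 1) (hW : IsChannel W)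
    (hac : condAbsCont P V W) : 0 ≤ condKL P V W := by
  refine Finset.sum_nonneg fun a _ => ?_
  by_cases ha : P a = 0
  · simp [ha]
  refine mul_nonneg (hP a) ?_
  have hb : ∀ b, V a b - W a b ≤ V a b * Real.log (V a b / W a b) := by
    intro b
    rcases (hV a b).eq_or_lt with h0 | hpos
    · rw [← h0]
      simpa using hW.1 a b
    · have hWpos : 0 < W a b := lt_of_le_of_ne (hW.1 a b) (hac a b ha hpos.ne').symm
      have h := mul_le_mul_of_nonneg_left
        (Real.one_sub_inv_le_log_of_pos (div_pos hpos hWpos)) hpos.le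
      rw [inv_div, mul_sub, mul_one, mul_div_cancel₀ _ hpos.ne'] at h
      exact h
  have hsum := Finset.sum_le_sum fun b (_ : b ∈ Finset.univ) => hb b
  rw [Finset.sum_sub_distrib, hV1 a ha, hW.2 a, sub_self] at hsum
  exact hsum

/-- Uniform continuity of conditional entropy in terms of divergences. -/
theorem exists_abs_condEnt_sub_le (X Y : Type) [Fintype X] [Fintype Y] {ε : ℝ} (hε : 0 < ε) :
    ∃ δ₀ > 0, ∀ δ ≤ δ₀, ∀ P Q : X → ℝ, IsPM P → IsPM Q → absCont Q P → klDiv Q P ≤ δ →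
      ∀ V W : X → Y → ℝ, (∀ a b, 0 ≤ V a b) → (∀ a, Q a ≠ 0 → ∑ b, V a b = 1) → IsChannel W →
      condAbsCont Q V W → condKL Q V W ≤ δ → |condEnt Q V - condEnt P W| ≤ ε := by
  let K : ℝ := Fintype.card X * (Fintype.card Y + 1) + 1
  have hK : 0 < K := by positivity
  have huc : UniformContinuousOn Real.negMulLog (Set.Icc 0 1) :=
    isCompact_Icc.uniformContinuousOn_of_continuous Real.continuous_negMulLog.continuousOn
  obtain ⟨r, hr, hmod⟩ := Metric.uniformContinuousOn_iff.1 huc (ε / K) (by positivity)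
  refine ⟨(r / 5) ^ 2, by positivity, ?_⟩
  intro δ hδ P Q hP hQ hQP hD V W hV hV1 hW hVW hDc
  have hsqrt : √δ ≤ r / 5 := (Real.sqrt_le_sqrt hδ).trans (Real.sqrt_sq (by positivity)).le
  have hPQ : ∀ a, |Q a - P a| ≤ 2 * √δ :=
    abs_sub_le_of_sum_mul_log_le Q P δ hQ.1 hP.1 hQ.le_one hP.le_one (hQ.2.trans hP.2.symm)
      hQP hD
  have hVle : ∀ a b, Q a * V a b ≤ 1 := by
    intro a b
    by_cases ha : Q a = 0
    · simp [ha]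
    · have : V a b ≤ 1 := (hV1 a ha) ▸
        Finset.single_le_sum (f := V a) (fun j _ => hV a j) (Finset.mem_univ b)
      exact mul_le_one₀ (hQ.le_one a) (hV a b) this
  have hjoint : ∀ p : X × Y, |Q p.1 * V p.1 p.2 - Q p.1 * W p.1 p.2| ≤ 2 * √δ := by
    refine abs_sub_le_of_sum_mul_log_le (fun p : X × Y => Q p.1 * V p.1 p.2)
      (fun p : X × Y => Q p.1 * W p.1 p.2) δ (fun p => mul_nonneg (hQ.1 _) (hV _ _))
      (fun p => mul_nonneg (hQ.1 _) (hW.1 _ _)) (fun p => hVle _ _)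
      (fun p => mul_le_one₀ (hQ.le_one _) (hW.1 _ _) (hW.le_one _ _)) ?_ ?_ ?_
    · rw [Fintype.sum_prod_type, Fintype.sum_prod_type]
      refine Finset.sum_congr rfl fun a _ => ?_
      simp only [← Finset.mul_sum]
      by_cases ha : Q a = 0
      · simp [ha]
      · rw [hV1 a ha, hW.2 a]
    · intro p hp
      have h1 := left_ne_zero_of_mul hp
      exact mul_ne_zero h1 (hVW _ _ h1 (right_ne_zero_of_mul hp))
    · refine le_of_eq_of_le ?_ hDc
      rw [condKL, Fintype.sum_prod_type]
      refine Finset.sum_congr rfl fun a _ => ?_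
      rw [Finset.mul_sum]
      refine Finset.sum_congr rfl fun b _ => ?_
      by_cases ha : Q a = 0
      · simp [ha]
      · simp only
        rw [mul_div_mul_left _ _ ha, mul_assoc]
  have h1 : ∀ a, |Real.negMulLog (Q a) - Real.negMulLog (P a)| ≤ ε / K := by
    intro a
    refine (hmod _ ⟨hQ.1 a, hQ.le_one a⟩ _ ⟨hP.1 a, hP.le_one a⟩ ?_).le
    rw [Real.dist_eq]
    linarith [hPQ a]
  have h2 : ∀ a b, |Real.negMulLog (Q a * V a b) - Real.negMulLog (P a * W a b)| ≤ ε / K := by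
    intro a b
    refine (hmod _ ⟨mul_nonneg (hQ.1 a) (hV a b), hVle a b⟩ _
      ⟨mul_nonneg (hP.1 a) (hW.1 a b),
        mul_le_one₀ (hP.le_one a) (hW.1 a b) (hW.le_one a b)⟩ ?_).le
    have h3 : |Q a * W a b - P a * W a b| ≤ 2 * √δ := by
      rw [← sub_mul, abs_mul, abs_of_nonneg (hW.1 a b)]
      exact (mul_le_of_le_one_right (abs_nonneg _) (hW.le_one a b)).trans (hPQ a)
    rw [Real.dist_eq]
    have := abs_sub_le (Q a * V a b) (Q a * W a b) (P a * W a b)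
    linarith [hjoint (a, b)]
  rw [condEnt_eq_sum_negMulLog Q V hV1, condEnt_eq_sum_negMulLog P W fun a _ => hW.2 a,
    ← Finset.sum_sub_distrib]
  have h3 : ∀ a, |(∑ b, Real.negMulLog (Q a * V a b) - Real.negMulLog (Q a)) -
      (∑ b, Real.negMulLog (P a * W a b) - Real.negMulLog (P a))| ≤
      (Fintype.card Y + 1) * (ε / K) := by
    intro a
    have h4 : |∑ b, (Real.negMulLog (Q a * V a b) - Real.negMulLog (P a * W a b))| ≤
        Fintype.card Y * (ε / K) := by
      refine (Finset.abs_sum_le_sum_abs _ _).trans ?_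
      simpa using Finset.sum_le_sum fun b (_ : b ∈ Finset.univ) => h2 a b
    rw [Finset.sum_sub_distrib] at h4
    have h5 := h1 a
    rw [abs_le] at h4 h5 ⊢
    constructor <;> linarith [h4.1, h4.2, h5.1, h5.2]
  refine (Finset.abs_sum_le_sum_abs _ _).trans
    ((Finset.sum_le_sum fun a _ => h3 a).trans ?_)
  rw [Finset.sum_const, nsmul_eq_mul, Finset.card_univ]
  calc (Fintype.card X : ℝ) * ((Fintype.card Y + 1) * (ε / K))
      = (K - 1) * (ε / K) := by simp only [K]; ring
    _ ≤ K * (ε / K) := by gcongr; linarith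
    _ = ε := by field_simp

end Continuity

theorem eventually_two_mul_pow_le_exp_sqrt (k : ℕ) :
    ∀ᶠ n : ℕ in Filter.atTop, 2 * ((n : ℝ) + 1) ^ k ≤ Real.exp (√n) := by
  have hs : Filter.Tendsto (fun n : ℕ => √(n : ℝ)) Filter.atTop Filter.atTop :=
    Real.tendsto_sqrt_atTop.comp tendsto_natCast_atTop_atTop
  have ht := (Real.tendsto_pow_mul_exp_neg_atTop_nhds_zero (2 * k)).comp hs
  have hpos : (0 : ℝ) < 1 / (2 * 2 ^ k) := by positivity
  filter_upwards [ht.eventually (gt_mem_nhds hpos), Filter.eventually_ge_atTop 1] with n hn h1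
  have h1' : (1 : ℝ) ≤ n := by exact_mod_cast h1
  simp only [Function.comp, pow_mul, Real.sq_sqrt (Nat.cast_nonneg n), Real.exp_neg] at hn
  rw [← div_eq_mul_inv, div_lt_iff₀ (Real.exp_pos _), div_mul_eq_mul_div, one_mul,
    lt_div_iff₀ (by positivity)] at hn
  calc 2 * ((n : ℝ) + 1) ^ k ≤ 2 * (2 * n) ^ k := by gcongr; linarith
    _ = n ^ k * (2 * 2 ^ k) := by rw [mul_pow]; ring
    _ ≤ _ := hn.le

section Cardinality

variable {X Y : Type} [Fintype X] [Fintype Y] [DecidableEq X] [DecidableEq Y]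

/-- A set of conditionally typical sequences whose empirical conditional entropies are at most `h`
has at most `(n + 1) ^ |X × Y| * exp (n h)` elements. -/
theorem card_le_of_condEnt_le {n : ℕ} (x : Fin n → X) (B : Finset (Fin n → Y)) (h : ℝ)
    (hB : ∀ y ∈ B, condEnt (emp n x) (empCond n x y) ≤ h) :
    (B.card : ℝ) ≤ ((n : ℝ) + 1) ^ (Fintype.card (X × Y)) * Real.exp (n * h) := by
  have hpt : ∀ y ∈ B, (1 : ℝ) ≤ (∏ i, empCond n x y (x i) (y i)) * Real.exp (n * h) := by
    intro y hy
    rw [prod_empCond, ← Real.exp_add, Real.one_le_exp_iff]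
    have := mul_le_mul_of_nonneg_left (hB y hy) (Nat.cast_nonneg (α := ℝ) n)
    linarith
  calc (B.card : ℝ) = ∑ y ∈ B, (1 : ℝ) := by simp
    _ ≤ ∑ y ∈ B, (∏ i, empCond n x y (x i) (y i)) * Real.exp (n * h) := Finset.sum_le_sum hpt
    _ ≤ ∑ y : Fin n → Y, (∏ i, empCond n x y (x i) (y i)) * Real.exp (n * h) :=
        Finset.sum_le_sum_of_subset_of_nonneg (Finset.subset_univ _) fun y _ _ =>
          mul_nonneg (Finset.prod_nonneg fun i _ => empCond_nonneg x y _ _) (Real.exp_nonneg _)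
    _ ≤ _ := by
        rw [← Finset.sum_mul]
        gcongr
        exact sum_prod_empCond_le x

/-- A conditionally typical set of probability at least one half, in which all empirical
conditional entropies are at least `h`, has at least `exp (n h) / 2` elements. -/
theorem le_card_typY {n : ℕ} (x : Fin n → X) (V : X → Y → ℝ) (hV : IsChannel V) (δ h : ℝ)
    (hδn : 2 * ((n : ℝ) + 1) ^ (Fintype.card (X × Y)) ≤ Real.exp (n * δ))
    (hT : ∀ y ∈ typY V n x δ, h ≤ condEnt (emp n x) (empCond n x y)) :
    Real.exp (n * h) / 2 ≤ ((typY V n x δ).card : ℝ) := by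
  have htot := sum_prod_eq_one x V fun i => hV.2 (x i)
  rw [← Finset.sum_add_sum_compl (typY V n x δ)] at htot
  have hcompl := sum_not_typY_le x V hV δ
  rw [Real.exp_neg, ← div_eq_mul_inv] at hcompl
  have hhalf : ((n : ℝ) + 1) ^ (Fintype.card (X × Y)) / Real.exp (n * δ) ≤ 1 / 2 := by
    rw [div_le_div_iff₀ (Real.exp_pos _) two_pos]
    linarith
  have hpt : ∀ y ∈ typY V n x δ, ∏ i, V (x i) (y i) ≤ Real.exp (-(n * h)) := by
    intro y hy
    have hac : condAbsCont (emp n x) (empCond n x y) V := by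
      simp only [typY, Finset.mem_filter] at hy
      exact hy.2.1
    have hD := condKL_nonneg (emp n x) (empCond n x y) V (emp_nonneg x) (empCond_nonneg x y)
      (sum_empCond x y) hV hac
    rw [prod_channel_eq x y V hV hac, prod_empCond, ← Real.exp_add]
    refine Real.exp_le_exp.2 ?_
    nlinarith [mul_le_mul_of_nonneg_left (hT y hy) (Nat.cast_nonneg (α := ℝ) n),
      mul_nonneg (Nat.cast_nonneg (α := ℝ) n) hD]
  have hsum := Finset.sum_le_sum hpt
  rw [Finset.sum_const, nsmul_eq_mul, Real.exp_neg, ← div_eq_mul_inv] at hsum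
  have h12 : 1 / 2 ≤ ((typY V n x δ).card : ℝ) / Real.exp (n * h) := by linarith
  rw [le_div_iff₀ (Real.exp_pos _)] at h12
  linarith

end Cardinality

/-- Pointwise upper bounds that hold eventually, uniformly over finite index sets, give a common
null sequence of bounds. -/
theorem exists_tendsto_zero_of_eventually_le {ι : ℕ → Type*} [∀ n, Fintype (ι n)]
    (s : ∀ n, Finset (ι n)) (f : ∀ n, ι n → ℝ) (hf : ∀ n i, 0 ≤ f n i)
    (h : ∀ ε > 0, ∀ᶠ n in Filter.atTop, ∀ i ∈ s n, f n i ≤ ε) :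
    ∃ η : ℕ → ℝ, Filter.Tendsto η Filter.atTop (nhds 0) ∧ ∀ n, ∀ i ∈ s n, f n i ≤ η n := by
  refine ⟨fun n => ⨆ i : s n, f n i, ?_, fun n i hi =>
    le_ciSup (f := fun i : s n => f n i) (Set.finite_range _).bddAbove ⟨i, hi⟩⟩
  rw [Metric.tendsto_nhds]
  intro ε hε
  filter_upwards [h (ε / 2) (half_pos hε)] with n hn
  have h0 : 0 ≤ ⨆ i : s n, f n i := Real.iSup_nonneg fun i => hf n i
  have h1 : ⨆ i : s n, f n i ≤ ε / 2 := Real.iSup_le (fun i => hn i i.2) (half_pos hε).le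
  rw [Real.dist_eq, sub_zero, abs_of_nonneg h0]
  linarith

theorem robust_typical_cardinality
    (X Y Θ : Type) [Fintype X] [Fintype Y] [Nonempty X] [Nonempty Y]
    [DecidableEq X] [DecidableEq Y]
    (W : Θ → X → Y → ℝ) (hW : ∀ θ, IsChannel (W θ))
    (P : X → ℝ) (hP : IsPM P) (Λ : Set Θ)
    (δseq : ℕ → ℝ) (hδseq : IsDeltaSeq δseq)
    (hopen : ∀ n : ℕ, relOpen ((fun θ => W θ) '' Λ) (empCondSet X Y n)) :
    ∃ η : ℕ → ℝ, Filter.Tendsto η Filter.atTop (nhds 0) ∧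
      ∃ n₀ : ℕ, ∀ n : ℕ, n₀ ≤ n → ∀ x ∈ typX P n (δseq n),
        |(n : ℝ)⁻¹ * Real.log ((robustTyp W n Λ x (δseq n)).card : ℝ) -
            entSup W Λ P| ≤ η n := by
  suffices h : ∀ ε > 0, ∀ᶠ n in Filter.atTop, ∀ x ∈ typX P n (δseq n),
      |(n : ℝ)⁻¹ * Real.log ((robustTyp W n Λ x (δseq n)).card : ℝ) - entSup W Λ P| ≤ ε by
    obtain ⟨η, hη, hle⟩ := exists_tendsto_zero_of_eventually_le _ _ (fun n x => abs_nonneg _) h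
    exact ⟨η, hη, 0, fun n _ => hle n⟩
  intro ε hε
  rcases Λ.eq_empty_or_nonempty with rfl | ⟨θ₀, hθ₀⟩
  · refine Filter.Eventually.of_forall fun n x _ => ?_
    simpa [robustTyp, entSup] using hε.le
  obtain ⟨δ₀, hδ₀, hcont⟩ := exists_abs_condEnt_sub_le X Y (half_pos hε)
  have hs : Filter.Tendsto (fun n : ℕ => √(n : ℝ)) Filter.atTop Filter.atTop :=
    Real.tendsto_sqrt_atTop.comp tendsto_natCast_atTop_atTop
  filter_upwards [hδseq.1.eventually (ge_mem_nhds hδ₀), hδseq.2.eventually_ge_atTop 1,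
    eventually_two_mul_pow_le_exp_sqrt (Fintype.card (X × Y)), hs.eventually_ge_atTop (2 / ε),
    Filter.eventually_ge_atTop 1] with n hδn hsn hpow hsε hn x hx
  have hn0 : (0 : ℝ) < n := by exact_mod_cast hn
  have hsq : √(n : ℝ) * √(n : ℝ) = n := Real.mul_self_sqrt hn0.le
  have hspos : 0 < √(n : ℝ) := Real.sqrt_pos.2 hn0
  have hsqrt_le : √(n : ℝ) ≤ n * (ε / 2) := by
    rw [div_le_iff₀ hε] at hsε
    nlinarith
  have hδexp : √(n : ℝ) ≤ n * δseq n := by nlinarith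
  have hxP : absCont (emp n x) P ∧ klDiv (emp n x) P ≤ δseq n := by
    simpa [typX] using hx
  have hemp : IsPM (emp n x) := ⟨emp_nonneg x, sum_emp hn x⟩
  have hclose : ∀ θ, ∀ y ∈ typY (W θ) n x (δseq n),
      |condEnt (emp n x) (empCond n x y) - condEnt P (W θ)| ≤ ε / 2 := by
    intro θ y hy
    obtain ⟨hac, hD⟩ : condAbsCont (emp n x) (empCond n x y) (W θ) ∧
        condKL (emp n x) (empCond n x y) (W θ) ≤ δseq n := by simpa [typY] using hy
    exact hcont _ hδn P _ hP hemp hxP.1 hxP.2 _ _ (empCond_nonneg x y) (sum_empCond x y)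
      (hW θ) hac hD
  have hbdd : BddAbove ((fun θ => condEnt P (W θ)) '' Λ) :=
    ⟨Fintype.card Y, by rintro _ ⟨θ, -, rfl⟩; exact condEnt_le_card hP (hW θ)⟩
  have hlower : ∀ θ ∈ Λ, Real.exp (n * (condEnt P (W θ) - ε / 2)) / 2 ≤
      ((robustTyp W n Λ x (δseq n)).card : ℝ) := by
    intro θ hθ
    refine (le_card_typY x (W θ) (hW θ) (δseq n) _
      (hpow.trans (Real.exp_le_exp.2 hδexp)) fun y hy => ?_).trans ?_
    · linarith [(abs_le.1 (hclose θ y hy)).1]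
    · exact_mod_cast Finset.card_le_card fun y hy => by
        simpa [robustTyp] using ⟨θ, hθ, hy⟩
  have hcard : (0 : ℝ) < ((robustTyp W n Λ x (δseq n)).card : ℝ) :=
    lt_of_lt_of_le (by positivity) (hlower θ₀ hθ₀)
  have hupper := card_le_of_condEnt_le x (robustTyp W n Λ x (δseq n)) (entSup W Λ P + ε / 2) (by
    intro y hy
    obtain ⟨θ, hθ, hy⟩ : ∃ θ ∈ Λ, y ∈ typY (W θ) n x (δseq n) := by simpa [robustTyp] using hy
    have : condEnt P (W θ) ≤ entSup W Λ P := le_csSup hbdd ⟨θ, hθ, rfl⟩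
    linarith [(abs_le.1 (hclose θ y hy)).2])
  have hone : (1 : ℝ) ≤ ((n : ℝ) + 1) ^ Fintype.card (X × Y) := one_le_pow₀ (by linarith)
  rw [abs_le]
  constructor
  · have hsup : entSup W Λ P ≤
        (n : ℝ)⁻¹ * Real.log ((robustTyp W n Λ x (δseq n)).card : ℝ) + ε := by
      refine csSup_le ⟨_, θ₀, hθ₀, rfl⟩ ?_
      rintro _ ⟨θ, hθ, rfl⟩
      have h2 : (2 : ℝ) ≤ Real.exp (n * (ε / 2)) :=
        (by linarith : (2 : ℝ) ≤ _).trans (hpow.trans (Real.exp_le_exp.2 hsqrt_le))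
      have h3 : Real.exp (n * (condEnt P (W θ) - ε)) ≤
          ((robustTyp W n Λ x (δseq n)).card : ℝ) := by
        refine le_trans ?_ (hlower θ hθ)
        rw [le_div_iff₀ two_pos]
        calc _ ≤ Real.exp (n * (condEnt P (W θ) - ε)) * Real.exp (n * (ε / 2)) := by gcongr
          _ = _ := by rw [← Real.exp_add]; ring_nf
      have h4 := (Real.le_log_iff_exp_le hcard).2 h3
      rw [mul_comm, ← le_div_iff₀ hn0, div_eq_inv_mul] at h4
      linarith
    linarith
  · have h5 : ((robustTyp W n Λ x (δseq n)).card : ℝ) ≤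
        Real.exp (n * (entSup W Λ P + ε)) := by
      refine hupper.trans ?_
      calc _ ≤ Real.exp (n * (ε / 2)) * Real.exp (n * (entSup W Λ P + ε / 2)) := by
            gcongr
            exact (by linarith : ((n : ℝ) + 1) ^ Fintype.card (X × Y) ≤ _).trans
              (hpow.trans (Real.exp_le_exp.2 hsqrt_le))
        _ = _ := by rw [← Real.exp_add]; ring_nf
    have h6 := (Real.log_le_iff_le_exp hcard).2 h5
    rw [mul_comm, ← div_le_iff₀ hn0, div_eq_inv_mul] at h6
    linarith
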